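/- Fix N ≥ 1 and v : Fin N → ℂ. Then the set { u : Fin N → ℂ | for every k with 1 ≤ k ≤ N, ∑_i (u i)^k = ∑_i (v i)^k } is finite and has at most N! elements. (The Bézout bound on the number of solutions of the bipartite system, used in the proof of Lemma B.2.) -/

import Mathlib

/-- By Newton's identities, the first `N` power sums determine the elementary symmetric
functions up to degree `N`, in characteristic zero. -/
theorem MvPolynomial.aeval_esymm_eq_of_sum_pow_eq {σ K : Type*} [Fintype σ] [Field K] [CharZero K]
    {N : ℕ} {u v : σ → K}
    (h : ∀ k, 1 ≤ k → k ≤ N → ∑ i, u i ^ k = ∑ i, v i ^ k) (k : ℕ) (hk : k ≤ N) :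
    aeval u (esymm σ K k) = aeval v (esymm σ K k) := by
  induction k using Nat.strong_induction_on with
  | _ k ih =>
    rcases Nat.eq_zero_or_pos k with rfl | hpos
    · simp
    have hk0 : (k : K) ≠ 0 := by exact_mod_cast hpos.ne'
    apply mul_left_cancel₀ hk0
    have hu := congrArg (aeval u) (mul_esymm_eq_sum σ K k)
    have hv := congrArg (aeval v) (mul_esymm_eq_sum σ K k)
    simp only [map_mul, map_natCast, map_pow, map_neg, map_one, map_sum] at hu hv
    rw [hu, hv]
    congr 1
    refine Finset.sum_congr rfl fun a ha => ?_
    simp only [Finset.mem_filter, Finset.HasAntidiagonal.mem_antidiagonal] at ha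
    rw [ih a.1 ha.2 (by omega)]
    simp only [psum, map_sum, map_pow, aeval_X]
    rw [h a.2 (by omega) (by omega)]

/-- Two families in a field of characteristic zero with the same first `card σ` power sums
agree as multisets. -/
theorem Multiset.map_univ_eq_of_sum_pow_eq {σ K : Type*} [Fintype σ] [Field K] [CharZero K]
    {u v : σ → K}
    (h : ∀ k, 1 ≤ k → k ≤ Fintype.card σ → ∑ i, u i ^ k = ∑ i, v i ^ k) :
    Finset.univ.val.map u = Finset.univ.val.map v := by
  have key : ((Finset.univ.val.map u).map fun t => Polynomial.X - Polynomial.C t).prod =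
      ((Finset.univ.val.map v).map fun t => Polynomial.X - Polynomial.C t).prod := by
    rw [Multiset.prod_X_sub_X_eq_sum_esymm, Multiset.prod_X_sub_X_eq_sum_esymm]
    simp only [Multiset.card_map]
    refine Finset.sum_congr rfl fun j hj => ?_
    have hj' : j ≤ Fintype.card σ := by
      simpa [Nat.lt_succ_iff] using hj
    have := MvPolynomial.aeval_esymm_eq_of_sum_pow_eq h j hj'
    rw [MvPolynomial.aeval_esymm_eq_multiset_esymm,
      MvPolynomial.aeval_esymm_eq_multiset_esymm] at this
    rw [this]
  simpa only [Polynomial.roots_multiset_prod_X_sub_C] using congrArg Polynomial.roots key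

/-- Two families with the same multiset of values differ by a permutation of the indices. -/
theorem Multiset.exists_perm_of_map_univ_eq {σ α : Type*} [Fintype σ] {u v : σ → α}
    (h : Finset.univ.val.map u = Finset.univ.val.map v) :
    ∃ e : Equiv.Perm σ, v ∘ e = u := by
  classical
  have hcard (a : α) : Fintype.card {i // u i = a} = Fintype.card {i // v i = a} := by
    have := congrArg (Multiset.count a) h
    simpa [Multiset.count_map, Fintype.card_subtype, Finset.card_def, eq_comm] using this
  refine ⟨Equiv.ofFiberEquiv (f := u) (g := v) fun a => Fintype.equivOfCardEq (hcard a), ?_⟩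
  ext i
  exact Equiv.ofFiberEquiv_map _ i

/-- The Bézout bound used in the proof of Lemma B.2: the solution set of the
bipartite power-sum system is finite, with at most `Nat.factorial N` elements. -/
theorem bipartite_system_card_solutions_le
    (N : ℕ) (hN : 1 ≤ N) (v : Fin N → ℂ) :
    ({ u : Fin N → ℂ | ∀ k : ℕ, 1 ≤ k → k ≤ N →
        ∑ i : Fin N, (u i) ^ k = ∑ i : Fin N, (v i) ^ k }).Finite ∧
      ({ u : Fin N → ℂ | ∀ k : ℕ, 1 ≤ k → k ≤ N →
        ∑ i : Fin N, (u i) ^ k = ∑ i : Fin N, (v i) ^ k }).ncard ≤ Nat.factorial N := by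
  have hsub : { u : Fin N → ℂ | ∀ k : ℕ, 1 ≤ k → k ≤ N →
      ∑ i : Fin N, (u i) ^ k = ∑ i : Fin N, (v i) ^ k } ⊆
      Set.range fun e : Equiv.Perm (Fin N) => v ∘ e := fun u hu =>
    Multiset.exists_perm_of_map_univ_eq
      (Multiset.map_univ_eq_of_sum_pow_eq (by simpa using hu))
  have hfin := Set.finite_range fun e : Equiv.Perm (Fin N) => v ∘ e
  refine ⟨hfin.subset hsub, (Set.ncard_le_ncard hsub hfin).trans ?_⟩
  rw [← Set.image_univ]
  refine (Set.ncard_image_le Set.finite_univ).trans ?_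
  simp [Set.ncard_univ, Nat.card_eq_fintype_card, Fintype.card_perm]
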